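/- arXiv:0904.1261 — 2 statements merged into one kernel-verified Lean document; each statement's English description precedes it below -/
import Mathlib

section
/- Let v(x) = c · max(0, x·ν) on ℝ² with c ≠ 0 and ν a unit vector. Then the identity ∫_{ℝ²} (|∇v|² div φ − 2 (∇v)ᵀ (Dφ) ∇v) dx = 0 fails for some φ ∈ C^∞_c(ℝ²; ℝ²); i.e., v is not a stationary point of the Dirichlet energy under domain variations. -/
open MeasureTheory Metric Set Filter
open scoped Topology ENNReal NNReal RealInnerProductSpace

noncomputable section

abbrev En (n : ℕ) := EuclideanSpace ℝ (Fin n)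

/-- The Laplacian of a scalar function, as the sum of second partial derivatives. -/
def lap {n : ℕ} (u : En n → ℝ) (x : En n) : ℝ :=
  ∑ i, fderiv ℝ (fun y => fderiv ℝ u y (EuclideanSpace.single i 1)) x
    (EuclideanSpace.single i 1)

/-- The divergence of a vector field. -/
def dvg {n : ℕ} (φ : En n → En n) (x : En n) : ℝ :=
  ∑ i, fderiv ℝ (fun y => φ y i) x (EuclideanSpace.single i 1)

/-- The derivative of the smooth function `exp (-1 / t)` glued with `0`. -/
theorem hasDerivAt_expNegInvGlue (t : ℝ) :
    HasDerivAt expNegInvGlue ((t⁻¹) ^ 2 * expNegInvGlue t) t := by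
  simpa using expNegInvGlue.hasDerivAt_polynomial_eval_inv_mul 1 t

theorem continuous_inv_sq_mul_expNegInvGlue :
    Continuous fun t : ℝ => (t⁻¹) ^ 2 * expNegInvGlue t := by
  refine (expNegInvGlue.continuous_polynomial_eval_inv_mul (Polynomial.X ^ 2)).congr fun t => ?_
  rw [Polynomial.eval_pow, Polynomial.eval_X]

section RadialBump

variable {n : ℕ}

/-- A smooth radially decreasing function supported in the closed unit ball. -/
def radialBump (x : En n) : ℝ := expNegInvGlue (1 - ‖x‖ ^ 2)

/-- Minus the derivative of the profile of `radialBump`, as a function of `‖x‖ ^ 2`. -/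
def radialBumpSlope (x : En n) : ℝ :=
  ((1 - ‖x‖ ^ 2)⁻¹) ^ 2 * expNegInvGlue (1 - ‖x‖ ^ 2)

theorem contDiff_radialBump : ContDiff ℝ (⊤ : ℕ∞) (radialBump (n := n)) :=
  expNegInvGlue.contDiff.comp (contDiff_const.sub (contDiff_norm_sq ℝ))

theorem expNegInvGlue_one_sub_norm_sq_eq_zero {x : En n} (hx : x ∉ closedBall (0 : En n) 1) :
    expNegInvGlue (1 - ‖x‖ ^ 2) = 0 := by
  apply expNegInvGlue.zero_of_nonpos
  rw [mem_closedBall_zero_iff, not_le] at hx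
  nlinarith

theorem hasCompactSupport_radialBump : HasCompactSupport (radialBump (n := n)) :=
  HasCompactSupport.intro (isCompact_closedBall 0 1)
    fun _ hx => expNegInvGlue_one_sub_norm_sq_eq_zero hx

theorem hasCompactSupport_radialBumpSlope : HasCompactSupport (radialBumpSlope (n := n)) :=
  HasCompactSupport.intro (isCompact_closedBall 0 1) fun _ hx => by
    simp [radialBumpSlope, expNegInvGlue_one_sub_norm_sq_eq_zero hx]

theorem continuous_radialBumpSlope : Continuous (radialBumpSlope (n := n)) :=
  continuous_inv_sq_mul_expNegInvGlue.comp (by fun_prop : Continuous fun x : En n => 1 - ‖x‖ ^ 2)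

theorem radialBumpSlope_nonneg (x : En n) : 0 ≤ radialBumpSlope x :=
  mul_nonneg (sq_nonneg _) (expNegInvGlue.nonneg _)

theorem radialBumpSlope_pos {x : En n} (hx : ‖x‖ < 1) : 0 < radialBumpSlope x := by
  have h : 0 < 1 - ‖x‖ ^ 2 := by nlinarith [norm_nonneg x]
  exact mul_pos (by positivity) (expNegInvGlue.pos_of_pos h)

theorem hasFDerivAt_radialBump (x : En n) :
    HasFDerivAt radialBump ((-2 * radialBumpSlope x) • innerSL ℝ x) x := by
  have h := (hasDerivAt_expNegInvGlue (1 - ‖x‖ ^ 2)).comp_hasFDerivAt x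
    ((hasStrictFDerivAt_norm_sq x).hasFDerivAt.const_sub 1)
  refine h.congr_fderiv ?_
  ext w
  simp [radialBumpSlope]
  ring

theorem fderiv_radialBump_smul (ν x w : En n) :
    fderiv ℝ (fun y => radialBump y • ν) x w = (-2 * radialBumpSlope x * ⟪x, w⟫) • ν := by
  rw [((hasFDerivAt_radialBump x).smul_const ν).fderiv]
  simp

theorem dvg_radialBump_smul (ν x : En n) :
    dvg (fun y => radialBump y • ν) x = -2 * radialBumpSlope x * ⟪x, ν⟫ := by
  have h (i : Fin n) : fderiv ℝ (fun y : En n => (radialBump y • ν) i) x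
      (EuclideanSpace.single i 1) = -2 * radialBumpSlope x * (x i * ν i) := by
    simp only [PiLp.smul_apply]
    rw [((hasFDerivAt_radialBump x).smul_const (ν i)).fderiv]
    simp [EuclideanSpace.inner_single_right]
    ring
  simp only [dvg, h, ← Finset.mul_sum]
  congr 1
  simp [PiLp.inner_apply, mul_comm]

end RadialBump

theorem gradient_const_mul_max_inner_of_pos {n : ℕ} (c : ℝ) {ν x : En n} (hx : 0 < ⟪x, ν⟫) :
    gradient (fun y : En n => c * max 0 ⟪y, ν⟫) x = c • ν := by
  apply HasGradientAt.gradient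
  have h : HasFDerivAt (fun y : En n => c * ⟪ν, y⟫) (c • innerSL ℝ ν) x :=
    (innerSL ℝ ν).hasFDerivAt.const_mul c
  have he : (fun y : En n => c * max 0 ⟪y, ν⟫) =ᶠ[𝓝 x] fun y => c * ⟪ν, y⟫ := by
    have hcont : Continuous fun y : En n => ⟪y, ν⟫ := by fun_prop
    filter_upwards [hcont.continuousAt.eventually (lt_mem_nhds hx)] with y hy
    rw [max_eq_right (le_of_lt hy), real_inner_comm]
  rw [hasGradientAt_iff_hasFDerivAt]
  refine (h.congr_of_eventuallyEq he).congr_fderiv ?_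
  ext w
  simp

theorem gradient_const_mul_max_inner_of_nonpos {n : ℕ} (c : ℝ) {ν x : En n} (hx : ⟪x, ν⟫ ≤ 0) :
    gradient (fun y : En n => c * max 0 ⟪y, ν⟫) x = 0 := by
  have h : IsLocalExtr (fun y : En n => c * max 0 ⟪y, ν⟫) x := by
    rcases le_total 0 c with hc | hc
    · refine Or.inl (Eventually.of_forall fun y => ?_)
      simpa [max_eq_left hx] using mul_nonneg hc (le_max_left 0 ⟪y, ν⟫)
    · refine Or.inr (Eventually.of_forall fun y => ?_)
      simpa [max_eq_left hx] using mul_nonpos_of_nonpos_of_nonneg hc (le_max_left 0 ⟪y, ν⟫)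
  rw [gradient, h.fderiv_eq_zero, map_zero]

/-- `v(x) = c·max(0, x·ν)` with `c ≠ 0` is not stationary for the Dirichlet energy under
domain variations: the domain-variation integral fails to vanish for some smooth compactly
supported vector field `φ`. -/
theorem stmt2 (c : ℝ) (hc : c ≠ 0) (ν : En 2) (hν : ‖ν‖ = 1)
    (v : En 2 → ℝ) (hv : ∀ x, v x = c * max 0 ⟪x, ν⟫) :
    ∃ φ : En 2 → En 2, ContDiff ℝ (⊤ : ℕ∞) φ ∧ HasCompactSupport φ ∧
      (∫ x, (‖gradient v x‖ ^ 2 * dvg φ x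
        - 2 * ⟪(fderiv ℝ φ x) (gradient v x), gradient v x⟫)) ≠ 0 := by
  obtain rfl : v = fun x => c * max 0 ⟪x, ν⟫ := funext hv
  have hνν : ⟪ν, ν⟫ = 1 := by rw [real_inner_self_eq_norm_sq, hν, one_pow]
  refine ⟨fun x => radialBump x • ν, contDiff_radialBump.smul contDiff_const,
    hasCompactSupport_radialBump.smul_right, ?_⟩
  have hint (x : En 2) : ‖gradient (fun x => c * max 0 ⟪x, ν⟫) x‖ ^ 2 *
        dvg (fun x => radialBump x • ν) x -
      2 * ⟪fderiv ℝ (fun x => radialBump x • ν) x (gradient (fun x => c * max 0 ⟪x, ν⟫) x),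
        gradient (fun x => c * max 0 ⟪x, ν⟫) x⟫ =
      radialBumpSlope x * (2 * c ^ 2 * max 0 ⟪x, ν⟫) := by
    rcases lt_or_ge 0 ⟪x, ν⟫ with hx | hx
    · rw [gradient_const_mul_max_inner_of_pos c hx, dvg_radialBump_smul, fderiv_radialBump_smul,
        max_eq_right hx.le, norm_smul, hν, mul_one, Real.norm_eq_abs, sq_abs,
        real_inner_smul_left, real_inner_smul_right, real_inner_smul_right, hνν]
      ring
    · rw [gradient_const_mul_max_inner_of_nonpos c hx, max_eq_left hx]
      simp
  simp only [hint]
  refine (Continuous.integral_pos_of_hasCompactSupport_nonneg_nonzero (x := (1 / 2 : ℝ) • ν)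
    (continuous_radialBumpSlope.mul (by fun_prop)) hasCompactSupport_radialBumpSlope.mul_right
    (fun x => mul_nonneg (radialBumpSlope_nonneg x) (by positivity)) ?_).ne'
  have hlt : ‖(1 / 2 : ℝ) • ν‖ < 1 := by
    rw [norm_smul, hν]
    norm_num
  refine mul_ne_zero (radialBumpSlope_pos hlt).ne' ?_
  simp only [real_inner_smul_left, hνν]
  norm_num [hc]
end
end

section
/- Let v_ε solve Δv_ε = β_ε(v_ε) on B_1 ⊂ ℝⁿ with ‖∇v_ε‖_{L^∞(D)} ≤ L on D ⊂⊂ B_1 and ∫_D β_ε(v_ε) dx ≤ C. Define χ_ε = 2B_ε(v_ε) where B_ε(z) = ∫₀^z β_ε. Then 0 ≤ χ_ε ≤ 1, ∫_D |∇χ_ε| dx ≤ 2LC, and hence the family {χ_ε} is precompact in L¹(D). -/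
open MeasureTheory Metric Set Filter
open scoped Topology ENNReal NNReal RealInnerProductSpace

noncomputable section

/-- A uniformly bounded sequence on a finite measure space has a subsequence whose integrals over
every measurable set converge, by weak sequential compactness in `L²`. -/
theorem exists_subseq_tendsto_setIntegral {α : Type*} [MeasurableSpace α]
    [MeasurableSpace.CountablyGenerated α] (ν : Measure α) [IsFiniteMeasure ν]
    (f : ℕ → α → ℝ) (hfm : ∀ k, Measurable (f k)) (hf : ∀ k x, |f k x| ≤ 1) :
    ∃ ψ : ℕ → ℕ, StrictMono ψ ∧ ∀ s, MeasurableSet s →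
      ∃ a, Tendsto (fun k => ∫ x in s, f (ψ k) x ∂ν) atTop (𝓝 a) := by
  have hmem (k : ℕ) : MemLp (f k) 2 ν :=
    MemLp.of_bound (hfm k).aestronglyMeasurable 1 (Eventually.of_forall (hf k))
  let F (k : ℕ) : WeakDual ℝ (Lp ℝ 2 ν) :=
    StrongDual.toWeakDual (InnerProductSpace.toDual ℝ (Lp ℝ 2 ν) (hmem k).toLp)
  have hFmem (k : ℕ) : F k ∈ WeakDual.toStrongDual ⁻¹'
      closedBall (0 : StrongDual ℝ (Lp ℝ 2 ν)) ((ν univ).toNNReal ^ (2 : ℝ)⁻¹ : ℝ) := by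
    have h : ‖(hmem k).toLp‖ ≤ ((ν univ).toNNReal ^ (2 : ℝ)⁻¹ : ℝ) * 1 := by
      have := Lp.norm_le_of_ae_bound (f := (hmem k).toLp) zero_le_one (by
        filter_upwards [(hmem k).coeFn_toLp] with x hx
        rw [hx]
        exact hf k x)
      simpa [measureUnivNNReal] using this
    rw [mem_preimage, mem_closedBall_zero_iff]
    change ‖InnerProductSpace.toDual ℝ (Lp ℝ 2 ν) (hmem k).toLp‖ ≤ _
    simpa using h
  have : Fact ((2 : ℝ≥0∞) ≠ ∞) := ⟨by simp⟩
  obtain ⟨a, -, ψ, hψ, hlim⟩ := WeakDual.isSeqCompact_closedBall ℝ (Lp ℝ 2 ν) _ _ hFmem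
  refine ⟨ψ, hψ, fun s hs => ⟨a (indicatorConstLp 2 hs (measure_ne_top ν s) 1), ?_⟩⟩
  have h := ((WeakDual.eval_continuous (𝕜 := ℝ)
    (indicatorConstLp 2 hs (measure_ne_top ν s) (1 : ℝ))).tendsto a).comp hlim
  refine h.congr fun k => ?_
  change inner ℝ ((hmem (ψ k)).toLp) (indicatorConstLp 2 hs (measure_ne_top ν s) (1 : ℝ)) = _
  rw [real_inner_comm, L2.inner_indicatorConstLp_one]
  exact setIntegral_congr_ae hs ((hmem (ψ k)).coeFn_toLp.mono fun x hx _ => hx)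

section Translation

variable {E : Type*} [NormedAddCommGroup E] [NormedSpace ℝ E]

theorem enorm_sub_le_lintegral_fderiv {f : E → ℝ} {D : Set E} (hD : IsOpen D)
    (hf : ContDiffOn ℝ 1 f D) {x z : E} (hxz : ∀ t ∈ Icc (0 : ℝ) 1, x + t • z ∈ D) :
    ‖f (x + z) - f x‖ₑ ≤
      ∫⁻ t in Icc (0 : ℝ) 1, ‖z‖ₑ * D.indicator (fun y => ‖fderiv ℝ f y‖ₑ) (x + t • z) := by
  have hc : Continuous fun t : ℝ => x + t • z := by fun_prop
  have hderiv : ∀ t ∈ uIcc (0 : ℝ) 1,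
      HasDerivAt (fun t : ℝ => f (x + t • z)) (fderiv ℝ f (x + t • z) z) t := by
    intro t ht
    rw [uIcc_of_le zero_le_one] at ht
    have h1 : HasFDerivAt f (fderiv ℝ f (x + t • z)) (x + t • z) :=
      ((hf.contDiffAt (hD.mem_nhds (hxz t ht))).differentiableAt one_ne_zero).hasFDerivAt
    have h2 : HasDerivAt (fun t : ℝ => x + t • z) z t := by
      simpa using ((hasDerivAt_id t).smul_const z).const_add x
    exact h1.comp_hasDerivAt t h2
  have hcont : ContinuousOn (fun t : ℝ => fderiv ℝ f (x + t • z) z) (Icc 0 1) :=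
    ((hf.continuousOn_fderiv_of_isOpen hD le_rfl).comp hc.continuousOn hxz).clm_apply
      continuousOn_const
  have hint : IntervalIntegrable (fun t : ℝ => fderiv ℝ f (x + t • z) z) volume 0 1 := by
    refine ContinuousOn.intervalIntegrable ?_
    rwa [uIcc_of_le zero_le_one]
  have h := intervalIntegral.integral_eq_sub_of_hasDerivAt hderiv hint
  simp only [one_smul, zero_smul, add_zero] at h
  rw [← h, intervalIntegral.integral_of_le zero_le_one, ← integral_Icc_eq_integral_Ioc]
  refine (enorm_integral_le_lintegral_enorm _).trans
    (setLIntegral_mono' measurableSet_Icc fun t ht => ?_)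
  rw [indicator_of_mem (hxz t ht), mul_comm]
  exact ContinuousLinearMap.le_opENorm _ _

variable [FiniteDimensional ℝ E] [MeasurableSpace E] [BorelSpace E]
  (μ : Measure E) [μ.IsAddHaarMeasure]

theorem lintegral_enorm_translate_sub_le {f : E → ℝ} {D K : Set E} (hD : IsOpen D)
    (hf : ContDiffOn ℝ 1 f D) (hK : MeasurableSet K) {z : E}
    (hKz : ∀ x ∈ K, ∀ t ∈ Icc (0 : ℝ) 1, x + t • z ∈ D) :
    ∫⁻ x in K, ‖f (x + z) - f x‖ₑ ∂μ ≤ ‖z‖ₑ * ∫⁻ x in D, ‖fderiv ℝ f x‖ₑ ∂μ := by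
  let G : E → ℝ≥0∞ := D.indicator fun y => ‖fderiv ℝ f y‖ₑ
  have hG : Measurable G := (measurable_fderiv ℝ f).enorm.indicator hD.measurableSet
  calc ∫⁻ x in K, ‖f (x + z) - f x‖ₑ ∂μ
      ≤ ∫⁻ x in K, (∫⁻ t in Icc (0 : ℝ) 1, ‖z‖ₑ * G (x + t • z)) ∂μ :=
        setLIntegral_mono' hK fun x hx => enorm_sub_le_lintegral_fderiv hD hf (hKz x hx)
    _ ≤ ∫⁻ x, (∫⁻ t in Icc (0 : ℝ) 1, ‖z‖ₑ * G (x + t • z)) ∂μ := setLIntegral_le_lintegral _ _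
    _ = ∫⁻ t in Icc (0 : ℝ) 1, ∫⁻ x, ‖z‖ₑ * G (x + t • z) ∂μ := by
        refine lintegral_lintegral_swap (Measurable.aemeasurable ?_)
        exact (hG.comp (by fun_prop)).const_mul _
    _ = ∫⁻ _ in Icc (0 : ℝ) 1, ‖z‖ₑ * ∫⁻ x in D, ‖fderiv ℝ f x‖ₑ ∂μ := by
        refine lintegral_congr fun t => ?_
        rw [lintegral_const_mul _ (by fun_prop), lintegral_add_right_eq_self G,
          lintegral_indicator hD.measurableSet]
    _ = _ := by simp

theorem lintegral_enorm_sub_average_le {f : E → ℝ} {D K : Set E} (hD : IsOpen D)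
    (hf : ContDiffOn ℝ 1 f D) (hfi : Measurable (D.indicator f)) (hb : ∀ x, |f x| ≤ 1)
    (hK : MeasurableSet K) {δ : ℝ} (hδ : 0 < δ) (hKδ : thickening δ K ⊆ D) :
    ∫⁻ x in K, ‖f x - ⨍ z in ball 0 δ, D.indicator f (x + z) ∂μ‖ₑ ∂μ
      ≤ ENNReal.ofReal δ * ∫⁻ x in D, ‖fderiv ℝ f x‖ₑ ∂μ := by
  have hmem : ∀ x ∈ K, ∀ z ∈ ball (0 : E) δ, x + z ∈ D := fun x hx z hz =>
    hKδ (mem_thickening_iff.2 ⟨x, hx, by simpa using hz⟩)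
  have hKD : K ⊆ D := (self_subset_thickening hδ K).trans hKδ
  have hpos : μ (ball (0 : E) δ) ≠ 0 := (measure_ball_pos μ 0 hδ).ne'
  have hfin : μ (ball (0 : E) δ) ≠ ∞ := measure_ball_lt_top.ne
  let ν : Measure E := (μ (ball (0 : E) δ))⁻¹ • μ.restrict (ball 0 δ)
  have hν : IsProbabilityMeasure ν := ⟨by
    simp [ν, ENNReal.inv_mul_cancel hpos hfin]⟩
  have hνae : ∀ᵐ z ∂ν, z ∈ ball (0 : E) δ :=
    (ae_restrict_mem measurableSet_ball).filter_mono (Measure.ae_smul_measure_le _)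
  have havg (x : E) : ⨍ z in ball 0 δ, D.indicator f (x + z) ∂μ
      = ∫ z, D.indicator f (x + z) ∂ν := by simp [average, ν]
  have hib (y : E) : ‖D.indicator f y‖ ≤ 1 :=
    (norm_indicator_le_norm_self _ _).trans (hb y)
  have hint (x : E) : Integrable (fun z => D.indicator f (x + z)) ν :=
    Integrable.of_bound (hfi.comp (by fun_prop)).aestronglyMeasurable 1
      (Eventually.of_forall fun z => hib _)
  have hm : Measurable fun p : E × E => ‖D.indicator f (p.1 + p.2) - D.indicator f p.1‖ₑ :=
    ((hfi.comp (by fun_prop)).sub (hfi.comp (by fun_prop))).enorm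
  calc ∫⁻ x in K, ‖f x - ⨍ z in ball 0 δ, D.indicator f (x + z) ∂μ‖ₑ ∂μ
      ≤ ∫⁻ x in K, ∫⁻ z, ‖D.indicator f (x + z) - D.indicator f x‖ₑ ∂ν ∂μ := by
        refine setLIntegral_mono' hK fun x hx => ?_
        have : f x - ⨍ z in ball 0 δ, D.indicator f (x + z) ∂μ
            = - ∫ z, (D.indicator f (x + z) - D.indicator f x) ∂ν := by
          rw [havg, integral_sub (hint x) (integrable_const _)]
          simp [indicator_of_mem (hKD hx)]
        rw [this, enorm_neg]
        exact enorm_integral_le_lintegral_enorm _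
    _ = ∫⁻ z, ∫⁻ x in K, ‖D.indicator f (x + z) - D.indicator f x‖ₑ ∂μ ∂ν :=
        lintegral_lintegral_swap hm.aemeasurable
    _ ≤ ∫⁻ _, ENNReal.ofReal δ * ∫⁻ x in D, ‖fderiv ℝ f x‖ₑ ∂μ ∂ν := by
        refine lintegral_mono_ae (hνae.mono fun z hz => ?_)
        have heq : ∫⁻ x in K, ‖D.indicator f (x + z) - D.indicator f x‖ₑ ∂μ
            = ∫⁻ x in K, ‖f (x + z) - f x‖ₑ ∂μ := by
          refine setLIntegral_congr_fun hK fun x hx => ?_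
          simp only [indicator_of_mem (hmem x hx z hz), indicator_of_mem (hKD hx)]
        rw [heq]
        refine (lintegral_enorm_translate_sub_le μ hD hf hK fun x hx t ht => ?_).trans ?_
        · refine hmem x hx _ ?_
          rw [mem_ball_zero_iff] at hz ⊢
          rw [norm_smul, Real.norm_of_nonneg ht.1]
          exact (mul_le_of_le_one_left (norm_nonneg _) ht.2).trans_lt hz
        · gcongr
          rw [← ofReal_norm]
          exact ENNReal.ofReal_le_ofReal (mem_ball_zero_iff.1 hz).le
    _ = _ := by simp

end Translation

theorem setAverage_translate_indicator {E : Type*} [NormedAddCommGroup E] [MeasurableSpace E]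
    [BorelSpace E] (μ : Measure E) [μ.IsAddLeftInvariant] (f : E → ℝ) {D : Set E}
    (hD : MeasurableSet D) (x : E) (δ : ℝ) : ⨍ z in ball 0 δ, D.indicator f (x + z) ∂μ
      = (μ.real (ball (0 : E) δ))⁻¹ * ∫ y in ball x δ, f y ∂μ.restrict D := by
  rw [setAverage_eq, smul_eq_mul, Measure.restrict_restrict measurableSet_ball,
    ← setIntegral_indicator hD, ← integral_indicator measurableSet_ball,
    ← integral_indicator measurableSet_ball,
    ← integral_add_left_eq_self ((ball x δ).indicator (D.indicator f)) x]
  congr 2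
  ext z
  simp [indicator]

section Compactness

variable {E : Type*} [NormedAddCommGroup E] [NormedSpace ℝ E] [FiniteDimensional ℝ E]
  [MeasurableSpace E] [BorelSpace E] (μ : Measure E) [μ.IsAddHaarMeasure]

/-- Rellich compactness for uniformly bounded `C¹` functions on an open set of finite measure: a
uniform `L¹` bound on the derivatives gives a subsequence converging in `L¹`. -/
theorem exists_subseq_tendsto_integral_abs_sub {D : Set E} (hD : IsOpen D) (hDfin : μ D ≠ ∞)
    (f : ℕ → E → ℝ) (hf : ∀ k, ContDiffOn ℝ 1 (f k) D) (hb : ∀ k x, |f k x| ≤ 1)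
    {M : ℝ≥0∞} (hM : M ≠ ∞) (hfM : ∀ k, ∫⁻ x in D, ‖fderiv ℝ (f k) x‖ₑ ∂μ ≤ M) :
    ∃ (ψ : ℕ → ℕ) (f₀ : E → ℝ), StrictMono ψ ∧ IntegrableOn f₀ D μ ∧
      Tendsto (fun k => ∫ x in D, |f (ψ k) x - f₀ x| ∂μ) atTop (𝓝 0) := by
  have hν : IsFiniteMeasure (μ.restrict D) := ⟨by simpa using hDfin.lt_top⟩
  have hfi (k : ℕ) : Measurable (D.indicator (f k)) := by
    classical
    rw [← piecewise_eq_indicator]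
    exact (hf k).continuousOn.measurable_piecewise continuousOn_const hD.measurableSet
  have hbi (k : ℕ) (x : E) : |D.indicator (f k) x| ≤ 1 :=
    (norm_indicator_le_norm_self (f k) x).trans (hb k x)
  obtain ⟨ψ, hψ, hlim⟩ := exists_subseq_tendsto_setIntegral (μ.restrict D) _ hfi hbi
  have hmem (k : ℕ) : MemLp (f (ψ k)) 1 (μ.restrict D) :=
    MemLp.of_bound ((hf _).continuousOn.aestronglyMeasurable hD.measurableSet) 1
      (Eventually.of_forall (hb _))
  have hcauchy : CauchySeq fun k => (hmem k).toLp := by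
    refine EMetric.cauchySeq_iff.2 fun η hη => ?_
    obtain ⟨η', hη'0, hη'⟩ : ∃ η' : ℝ≥0∞, 0 < η' ∧ 6 * η' < η := by
      obtain ⟨r, hr0, hr⟩ := exists_between hη
      refine ⟨r / 6, ENNReal.div_pos hr0.ne' (by simp), ?_⟩
      rwa [ENNReal.mul_div_cancel (by simp) (by simp)]
    obtain ⟨K, hKD, hK, hKη⟩ :=
      hD.measurableSet.exists_isCompact_sdiff_lt hDfin hη'0.ne'
    obtain ⟨δ₀, hδ₀, hKδ₀⟩ := hK.exists_thickening_subset_open hD hKD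
    obtain ⟨δ, hδM, hδ, hδδ₀⟩ : ∃ δ, ENNReal.ofReal δ * M < η' ∧ 0 < δ ∧ δ < δ₀ := by
      have h : Tendsto (fun δ : ℝ => ENNReal.ofReal δ * M) (𝓝[>] 0) (𝓝 0) := by
        have := ENNReal.Tendsto.mul_const (b := M)
          ((ENNReal.continuous_ofReal.tendsto 0).mono_left (nhdsWithin_le_nhds (s := Ioi 0)))
          (Or.inr hM)
        simpa using this
      exact ((h.eventually_lt_const hη'0).and
        (Ioo_mem_nhdsGT hδ₀)).exists
    have hKδ : thickening δ K ⊆ D := (thickening_mono hδδ₀.le K).trans hKδ₀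
    let A (k : ℕ) (x : E) : ℝ := ⨍ z in ball 0 δ, D.indicator (f (ψ k)) (x + z) ∂μ
    have hA (k : ℕ) : Measurable (A k) := by
      have : StronglyMeasurable fun p : E × E => D.indicator (f (ψ k)) (p.1 + p.2) :=
        ((hfi _).comp (by fun_prop)).stronglyMeasurable
      simp only [A, setAverage_eq, smul_eq_mul]
      exact (this.integral_prod_right' (ν := μ.restrict (ball 0 δ))).measurable.const_mul _
    have hAlim (x : E) : ∃ a, Tendsto (fun k => A k x) atTop (𝓝 a) := by
      obtain ⟨a, ha⟩ := hlim (ball x δ) measurableSet_ball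
      refine ⟨_, (ha.const_mul (μ.real (ball (0 : E) δ))⁻¹).congr fun k => ?_⟩
      simp only [A]
      rw [setAverage_translate_indicator μ _ hD.measurableSet]
      congr 1
      exact integral_congr_ae (ae_restrict_of_ae
        (indicator_ae_eq_restrict hD.measurableSet))
    choose a ha using hAlim
    have ham : Measurable a := measurable_of_tendsto_metrizable hA (tendsto_pi_nhds.2 ha)
    have hAb (k : ℕ) (x : E) : |A k x| ≤ 1 := by
      have hpos : 0 < μ.real (ball (0 : E) δ) :=
        ENNReal.toReal_pos (measure_ball_pos μ 0 hδ).ne' measure_ball_lt_top.ne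
      have h := norm_setIntegral_le_of_norm_le_const (μ := μ) (s := ball (0 : E) δ)
        (f := fun z => D.indicator (f (ψ k)) (x + z)) (C := 1) measure_ball_lt_top
        fun z _ => hbi _ _
      simp only [A, setAverage_eq, smul_eq_mul, abs_mul, abs_inv, abs_of_pos hpos]
      rw [inv_mul_le_iff₀ hpos]
      simpa using h
    have hab (x : E) : |a x| ≤ 1 := le_of_tendsto (ha x).abs (Eventually.of_forall (hAb · x))
    have hI : Tendsto (fun k => ∫⁻ x in K, ‖A k x - a x‖ₑ ∂μ) atTop (𝓝 0) := by
      have := tendsto_lintegral_of_dominated_convergence (μ := μ.restrict K)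
        (F := fun k x => ‖A k x - a x‖ₑ) (f := fun _ => 0) (fun _ => 2)
        (fun k => ((hA k).sub ham).enorm) (fun k => Eventually.of_forall fun x => ?_)
        ?_ (Eventually.of_forall fun x => ?_)
      · simpa using this
      · refine enorm_sub_le.trans ?_
        rw [← one_add_one_eq_two, ← ofReal_norm, ← ofReal_norm]
        exact add_le_add (ENNReal.ofReal_le_one.2 (hAb k x)) (ENNReal.ofReal_le_one.2 (hab x))
      · simpa using ENNReal.mul_ne_top (by simp) hK.measure_lt_top.ne
      · have := ((ha x).sub_const (a x)).enorm
        simpa using this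
    obtain ⟨N, hN⟩ := eventually_atTop.1 (hI.eventually_lt_const hη'0)
    have hfA (k : ℕ) : ∫⁻ x in K, ‖f (ψ k) x - A k x‖ₑ ∂μ ≤ η' :=
      (lintegral_enorm_sub_average_le μ hD (hf _) (hfi _) (hb _) hK.measurableSet hδ hKδ).trans
        ((mul_le_mul_right (hfM _) _).trans hδM.le)
    have hfa (k : ℕ) (hk : N ≤ k) : ∫⁻ x in K, ‖f (ψ k) x - a x‖ₑ ∂μ ≤ 2 * η' := by
      calc ∫⁻ x in K, ‖f (ψ k) x - a x‖ₑ ∂μ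
          ≤ ∫⁻ x in K, ‖f (ψ k) x - A k x‖ₑ + ‖A k x - a x‖ₑ ∂μ := by
            refine lintegral_mono fun x => ?_
            rw [← sub_add_sub_cancel _ (A k x)]
            exact enorm_add_le _ _
        _ = ∫⁻ x in K, ‖f (ψ k) x - A k x‖ₑ ∂μ + ∫⁻ x in K, ‖A k x - a x‖ₑ ∂μ :=
            lintegral_add_right _ ((hA k).sub ham).enorm
        _ ≤ η' + η' := add_le_add (hfA k) (hN k hk).le
        _ = 2 * η' := (two_mul _).symm
    refine ⟨N, fun k hk l hl => ?_⟩
    rw [Lp.edist_toLp_toLp, eLpNorm_one_eq_lintegral_enorm]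
    refine lt_of_le_of_lt ?_ hη'
    calc ∫⁻ x in D, ‖f (ψ k) x - f (ψ l) x‖ₑ ∂μ
        = ∫⁻ x in K ∪ D \ K, ‖f (ψ k) x - f (ψ l) x‖ₑ ∂μ := by rw [union_sdiff_cancel hKD]
      _ ≤ ∫⁻ x in K, ‖f (ψ k) x - f (ψ l) x‖ₑ ∂μ
          + ∫⁻ x in D \ K, ‖f (ψ k) x - f (ψ l) x‖ₑ ∂μ := lintegral_union_le _ _ _
      _ ≤ (2 * η' + 2 * η') + 2 * η' := by
          refine add_le_add ?_ ?_
          · calc ∫⁻ x in K, ‖f (ψ k) x - f (ψ l) x‖ₑ ∂μ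
                ≤ ∫⁻ x in K, ‖f (ψ k) x - a x‖ₑ + ‖f (ψ l) x - a x‖ₑ ∂μ := by
                  refine lintegral_mono fun x => ?_
                  rw [← sub_sub_sub_cancel_right _ _ (a x)]
                  exact enorm_sub_le
              _ = ∫⁻ x in K, ‖f (ψ k) x - a x‖ₑ ∂μ + ∫⁻ x in K, ‖f (ψ l) x - a x‖ₑ ∂μ := by
                  refine lintegral_add_left' ?_ _
                  exact (((hf _).continuousOn.mono hKD).aemeasurable
                    hK.measurableSet |>.sub ham.aemeasurable).enorm
              _ ≤ _ := add_le_add (hfa k hk) (hfa l hl)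
          · calc ∫⁻ x in D \ K, ‖f (ψ k) x - f (ψ l) x‖ₑ ∂μ
                ≤ ∫⁻ x in D \ K, 2 ∂μ := by
                  refine lintegral_mono fun x => enorm_sub_le.trans ?_
                  rw [← one_add_one_eq_two, ← ofReal_norm, ← ofReal_norm]
                  exact add_le_add (ENNReal.ofReal_le_one.2 (hb _ x))
                    (ENNReal.ofReal_le_one.2 (hb _ x))
              _ = 2 * μ (D \ K) := by simp
              _ ≤ 2 * η' := by gcongr
      _ = 6 * η' := by ring
  obtain ⟨F, hF⟩ := cauchySeq_tendsto_of_complete hcauchy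
  refine ⟨ψ, F, hψ, L1.integrable_coeFn F, ?_⟩
  refine (tendsto_iff_norm_sub_tendsto_zero.1 hF).congr fun k => ?_
  rw [L1.norm_eq_integral_norm]
  refine integral_congr_ae ?_
  filter_upwards [Lp.coeFn_sub (hmem k).toLp F, (hmem k).coeFn_toLp] with x hx hx'
  rw [hx, Pi.sub_apply, hx', Real.norm_eq_abs]

end Compactness

section Reaction

variable {β : ℝ → ℝ}

theorem integral_nonneg_and_le_of_support_Ioo (hβ : Continuous β)
    (hβpos : ∀ s ∈ Ioo (0 : ℝ) 1, 0 < β s) (hβ0 : ∀ s, s ∉ Ioo (0 : ℝ) 1 → β s = 0) (w : ℝ) :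
    0 ≤ ∫ s in (0 : ℝ)..w, β s ∧ ∫ s in (0 : ℝ)..w, β s ≤ ∫ s in (0 : ℝ)..1, β s := by
  have hnn (s : ℝ) : 0 ≤ β s := by
    by_cases hs : s ∈ Ioo (0 : ℝ) 1
    · exact (hβpos s hs).le
    · exact (hβ0 s hs).ge
  have hi (a b : ℝ) : IntervalIntegrable β volume a b := hβ.intervalIntegrable a b
  have hadd := intervalIntegral.integral_add_adjacent_intervals (hi 0 w) (hi w 1)
  rcases le_total w 0 with hw | hw
  · have h0 : ∫ s in (0 : ℝ)..w, β s = 0 := by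
      refine intervalIntegral.integral_zero_ae (Eventually.of_forall fun s hs => hβ0 s ?_)
      rw [uIoc_of_ge hw] at hs
      exact fun h => (h.1.trans_le hs.2).false
    rw [h0]
    exact ⟨le_rfl, intervalIntegral.integral_nonneg zero_le_one fun s _ => hnn s⟩
  · refine ⟨intervalIntegral.integral_nonneg hw fun s _ => hnn s, ?_⟩
    rcases le_total w 1 with hw1 | hw1
    · have := intervalIntegral.integral_nonneg (μ := volume) hw1 fun s _ => hnn s
      linarith
    · have h0 : ∫ s in w..1, β s = 0 := by
        refine intervalIntegral.integral_zero_ae (Eventually.of_forall fun s hs => hβ0 s ?_)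
        rw [uIoc_of_ge hw1] at hs
        exact fun h => (h.2.trans hs.1).false
      linarith

theorem hasDerivAt_two_mul_integral_rescaled (hβ : Continuous β) (ε z : ℝ) :
    HasDerivAt (fun z => 2 * ∫ s in (0 : ℝ)..z, ε⁻¹ * β (s / ε)) (2 * (ε⁻¹ * β (z / ε))) z :=
  ((Continuous.integral_hasStrictDerivAt (f := fun s => ε⁻¹ * β (s / ε)) (by fun_prop) 0 z
    ).hasDerivAt).const_mul 2

theorem contDiff_two_mul_integral_rescaled (hβ : Continuous β) (ε : ℝ) :
    ContDiff ℝ 1 fun z => 2 * ∫ s in (0 : ℝ)..z, ε⁻¹ * β (s / ε) := by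
  refine contDiff_one_iff_deriv.2
    ⟨fun z => (hasDerivAt_two_mul_integral_rescaled hβ ε z).differentiableAt, ?_⟩
  rw [show deriv (fun z => 2 * ∫ s in (0 : ℝ)..z, ε⁻¹ * β (s / ε))
    = fun z => 2 * (ε⁻¹ * β (z / ε)) from
      funext fun z => (hasDerivAt_two_mul_integral_rescaled hβ ε z).deriv]
  fun_prop

end Reaction

theorem norm_gradient_eq_norm_fderiv {F : Type*} [NormedAddCommGroup F] [InnerProductSpace ℝ F]
    [CompleteSpace F] (u : F → ℝ) (x : F) : ‖gradient u x‖ = ‖fderiv ℝ u x‖ := by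
  simp [gradient]

/-- Proposition 4.4: for solutions `v_ε` of `Δv_ε = β_ε(v_ε)` with uniform Lipschitz
bound on `D ⊂⊂ B₁` and uniform `L¹` reaction bound, the functions
`χ_ε = 2B_ε(v_ε)` satisfy `0 ≤ χ_ε ≤ 1`, `∫_D |∇χ_ε| ≤ 2LC`, and the family `{χ_ε}`
is (sequentially) precompact in `L¹(D)`. -/
theorem stmt11 {n : ℕ} (β : ℝ → ℝ) (Lβ : NNReal) (hβlip : LipschitzWith Lβ β)
    (hβpos : ∀ s ∈ Ioo (0:ℝ) 1, 0 < β s) (hβ0 : ∀ s, s ∉ Ioo (0:ℝ) 1 → β s = 0)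
    (hβint : (∫ s in (0:ℝ)..1, β s) = 1 / 2)
    (D : Set (En n)) (hD : IsOpen D) (hDc : IsCompact (closure D))
    (hDB : closure D ⊆ ball (0 : En n) 1)
    (L C : ℝ) (hL : 0 < L) (hC : 0 < C)
    (v : ℝ → En n → ℝ) (χ : ℝ → En n → ℝ)
    (hsol : ∀ ε : ℝ, 0 < ε → ContDiffOn ℝ 2 (v ε) (ball (0 : En n) 1) ∧
      (∀ x ∈ ball (0 : En n) 1, lap (v ε) x = ε⁻¹ * β (v ε x / ε)) ∧
      (∀ x ∈ D, ‖gradient (v ε) x‖ ≤ L) ∧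
      (∫ x in D, ε⁻¹ * β (v ε x / ε)) ≤ C)
    (hχ : ∀ ε : ℝ, 0 < ε → ∀ x, χ ε x = 2 * ∫ s in (0:ℝ)..(v ε x), ε⁻¹ * β (s / ε)) :
    (∀ ε : ℝ, 0 < ε → ∀ x, 0 ≤ χ ε x ∧ χ ε x ≤ 1) ∧
    (∀ ε : ℝ, 0 < ε → (∫ x in D, ‖gradient (χ ε) x‖) ≤ 2 * L * C) ∧
    (∀ εk : ℕ → ℝ, (∀ k, 0 < εk k) → Tendsto εk atTop (𝓝 0) →
      ∃ (ψ : ℕ → ℕ) (χ₀ : En n → ℝ), StrictMono ψ ∧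
        IntegrableOn χ₀ D ∧
        Tendsto (fun k => ∫ x in D, |χ (εk (ψ k)) x - χ₀ x|) atTop (𝓝 0)) := by
  have hβ : Continuous β := hβlip.continuous
  have hβnn (s : ℝ) : 0 ≤ β s := by
    by_cases hs : s ∈ Ioo (0 : ℝ) 1
    · exact (hβpos s hs).le
    · exact (hβ0 s hs).ge
  have hDsub : D ⊆ ball (0 : En n) 1 := subset_closure.trans hDB
  have hDfin : volume D ≠ ∞ := measure_ne_top_of_subset subset_closure hDc.measure_lt_top.ne
  have hχeq (ε : ℝ) (hε : 0 < ε) :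
      χ ε = (fun z => 2 * ∫ s in (0 : ℝ)..z, ε⁻¹ * β (s / ε)) ∘ v ε := funext (hχ ε hε)
  have hbound : ∀ ε : ℝ, 0 < ε → ∀ x, 0 ≤ χ ε x ∧ χ ε x ≤ 1 := by
    intro ε hε x
    have hscale : ∫ s in (0 : ℝ)..(v ε x), ε⁻¹ * β (s / ε) = ∫ s in (0 : ℝ)..(v ε x / ε), β s := by
      rw [intervalIntegral.integral_const_mul, intervalIntegral.inv_mul_integral_comp_div, zero_div]
    have h := integral_nonneg_and_le_of_support_Ioo hβ hβpos hβ0 (v ε x / ε)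
    rw [hχ ε hε, hscale]
    constructor <;> linarith
  have hcd (ε : ℝ) (hε : 0 < ε) : ContDiffOn ℝ 1 (χ ε) D := by
    rw [hχeq ε hε]
    exact (contDiff_two_mul_integral_rescaled hβ ε).comp_contDiffOn
      (((hsol ε hε).1.mono hDsub).of_le one_le_two)
  have hgrad (ε : ℝ) (hε : 0 < ε) (x : En n) (hx : x ∈ D) :
      ‖fderiv ℝ (χ ε) x‖ ≤ 2 * L * (ε⁻¹ * β (v ε x / ε)) := by
    have hv : DifferentiableAt ℝ (v ε) x :=
      ((hsol ε hε).1.contDiffAt (isOpen_ball.mem_nhds (hDsub hx))).differentiableAt two_ne_zero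
    have hd := (hasDerivAt_two_mul_integral_rescaled hβ ε (v ε x)).comp_hasFDerivAt x
      hv.hasFDerivAt
    rw [hχeq ε hε, hd.fderiv, norm_smul, ← norm_gradient_eq_norm_fderiv,
      Real.norm_of_nonneg (by have := hβnn (v ε x / ε); positivity)]
    have h1 := (hsol ε hε).2.2.1 x hx
    have h2 : 0 ≤ ε⁻¹ * β (v ε x / ε) := by have := hβnn (v ε x / ε); positivity
    nlinarith
  have hint (ε : ℝ) (hε : 0 < ε) : IntegrableOn (fun x => ε⁻¹ * β (v ε x / ε)) D := by
    have hvc : ContinuousOn (v ε) (closure D) := (hsol ε hε).1.continuousOn.mono hDB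
    refine (ContinuousOn.integrableOn_compact hDc ?_).mono_set subset_closure
    exact continuousOn_const.mul (hβ.comp_continuousOn (hvc.div_const ε))
  have htotal (ε : ℝ) (hε : 0 < ε) :
      ∫ x in D, 2 * L * (ε⁻¹ * β (v ε x / ε)) ≤ 2 * L * C := by
    rw [integral_const_mul]
    exact mul_le_mul_of_nonneg_left (hsol ε hε).2.2.2 (by positivity)
  refine ⟨hbound, fun ε hε => ?_, fun εk hεk _ => ?_⟩
  · refine le_trans (integral_mono_of_nonneg (Eventually.of_forall fun x => norm_nonneg _)
      ((hint ε hε).const_mul (2 * L)) ?_) (htotal ε hε)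
    filter_upwards [ae_restrict_mem hD.measurableSet] with x hx
    rw [norm_gradient_eq_norm_fderiv]
    exact hgrad ε hε x hx
  · refine exists_subseq_tendsto_integral_abs_sub volume hD hDfin (fun k => χ (εk k))
      (fun k => hcd _ (hεk k)) (fun k x => ?_) (M := ENNReal.ofReal (2 * L * C))
      ENNReal.ofReal_ne_top fun k => ?_
    · have h := hbound _ (hεk k) x
      rw [abs_of_nonneg h.1]
      exact h.2
    · refine le_trans ?_ (ENNReal.ofReal_le_ofReal (htotal _ (hεk k)))
      rw [ofReal_integral_eq_lintegral_ofReal ((hint _ (hεk k)).const_mul (2 * L))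
        (Eventually.of_forall fun x => by
          have := hβnn (v (εk k) x / εk k)
          have := hεk k
          simp only [Pi.zero_apply]
          positivity)]
      refine setLIntegral_mono' hD.measurableSet fun x hx => ?_
      rw [← ofReal_norm]
      exact ENNReal.ofReal_le_ofReal (hgrad _ (hεk k) x hx)
end
end
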